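/- Let p be a polynomial in ℂ[x,y] such that the quotient ℂ-algebra ℂ[x,y]/(p) is isomorphic as a ℂ-algebra to the univariate polynomial ring ℂ[t]. Then there exists a ℂ-algebra automorphism φ of ℂ[x,y] such that φ(p) = x; i.e., p is a coordinate function in a suitable polynomial coordinate system on ℂ². -/

import Mathlib

section
open Polynomial

namespace AMS

structure DVal (F : Type*) [Field F] (n : ℕ) where
  v : F[X] → WithBot ℤ
  v_zero : v 0 = ⊥
  v_mul : ∀ a b, v (a * b) = v a + v b
  v_add : ∀ a b, v (a + b) ≤ max (v a) (v b)
  v_neg : ∀ a, v (-a) = v a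
  v_C : ∀ a : F, a ≠ 0 → ∃ z : ℤ, v (C a) = ((n * z : ℤ) : WithBot ℤ)
  v_nat : ∀ d : ℕ, d ≠ 0 → v (C (d : F)) = ((0 : ℤ) : WithBot ℤ)

variable {F : Type*} [Field F] {n : ℕ}

namespace DVal
variable (V : DVal F n)

lemma v_one (V : DVal F n) : V.v 1 = ((0 : ℤ) : WithBot ℤ) := by
  obtain ⟨z, hz⟩ := V.v_C 1 one_ne_zero
  rw [map_one] at hz
  have h := V.v_mul 1 1
  rw [mul_one, hz, ← WithBot.coe_add, WithBot.coe_inj] at h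
  rw [hz, WithBot.coe_inj]; linarith

lemma v_add_of_lt {a b : F[X]} (h : V.v a < V.v b) : V.v (a + b) = V.v b := by
  apply le_antisymm
  · exact (V.v_add a b).trans (by rw [max_eq_right h.le])
  · have := V.v_add (a + b) (-a)
    rw [add_neg_cancel_comm, V.v_neg] at this
    rcases le_max_iff.1 this with h1 | h1
    · exact h1
    · exact absurd h1 (not_le.2 h)

lemma v_add_eq {a b : F[X]} (h : V.v a ≠ V.v b ∨ V.v a = ⊥) :
    V.v (a + b) = max (V.v a) (V.v b) := by
  rcases lt_trichotomy (V.v a) (V.v b) with h1 | h1 | h1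
  · rw [V.v_add_of_lt h1, max_eq_right h1.le]
  · rcases h with h | h
    · exact absurd h1 h
    · have := V.v_add a b
      rw [← h1, h] at this ⊢
      simpa using this
  · rw [add_comm, V.v_add_of_lt h1, max_eq_left h1.le]

lemma v_sum {ι : Type*} (s : Finset ι) (z : ι → F[X])
    (h : ∀ i ∈ s, ∀ j ∈ s, V.v (z i) = V.v (z j) → V.v (z i) = ⊥ ∨ i = j) :
    V.v (∑ i ∈ s, z i) = s.sup (fun i => V.v (z i)) := by
  classical
  induction s using Finset.induction_on with
  | empty => simp [V.v_zero]
  | insert a s ha ih =>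
    rw [Finset.sum_insert ha, Finset.sup_insert]
    have ih' := ih (fun i hi j hj => h i (Finset.mem_insert_of_mem hi) j (Finset.mem_insert_of_mem hj))
    rw [V.v_add_eq, ih']
    by_cases hb : V.v (z a) = ⊥
    · exact Or.inr hb
    · left
      rw [ih']
      rcases s.eq_empty_or_nonempty with rfl | hs
      · simpa using hb
      · obtain ⟨i, hi, he⟩ := Finset.exists_mem_eq_sup s hs (fun i => V.v (z i))
        rw [he]
        intro hh
        rcases h a (Finset.mem_insert_self _ _) i (Finset.mem_insert_of_mem hi) hh with h1 | h1
        · exact hb h1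
        · exact ha (h1 ▸ hi)

lemma v_sum_le {ι : Type*} (s : Finset ι) (z : ι → F[X]) (c : WithBot ℤ)
    (h : ∀ i ∈ s, V.v (z i) ≤ c) : V.v (∑ i ∈ s, z i) ≤ c := by
  classical
  induction s using Finset.induction_on with
  | empty => simp [V.v_zero]
  | insert a s ha ih =>
    rw [Finset.sum_insert ha]
    refine (V.v_add _ _).trans (max_le (h a (Finset.mem_insert_self _ _)) (ih ?_))
    exact fun i hi => h i (Finset.mem_insert_of_mem hi)

lemma v_pow {Q : F[X]} {δ : ℤ} (h : V.v Q = δ) (j : ℕ) : V.v (Q ^ j) = ((j * δ : ℤ) : WithBot ℤ) := by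
  induction j with
  | zero => simp [V.v_one]
  | succ j ih =>
    rw [pow_succ, V.v_mul, ih, h, ← WithBot.coe_add, WithBot.coe_inj]; push_cast; ring

end DVal

/-- digits of the `Q`-adic expansion -/
noncomputable def dig {R : Type*} [CommRing R] (Q : R[X]) : ℕ → R[X] → R[X]
  | 0, H => H %ₘ Q
  | j + 1, H => dig Q j (H /ₘ Q)

section dig
variable {R : Type*} [CommRing R] [Nontrivial R] {Q : R[X]}

lemma add_div (hQ : Q.Monic) (a b : R[X]) : (a + b) /ₘ Q = a /ₘ Q + b /ₘ Q := by
  refine (div_modByMonic_unique (a /ₘ Q + b /ₘ Q) (a %ₘ Q + b %ₘ Q) hQ ⟨?_, ?_⟩).1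
  · have h1 := modByMonic_add_div a Q
    have h2 := modByMonic_add_div b Q
    linear_combination h1 + h2
  · exact (degree_add_le _ _).trans_lt (max_lt (degree_modByMonic_lt _ hQ) (degree_modByMonic_lt _ hQ))

lemma dig_add (hQ : Q.Monic) (j : ℕ) (a b : R[X]) : dig Q j (a + b) = dig Q j a + dig Q j b := by
  induction j generalizing a b with
  | zero => simp [dig, add_modByMonic]
  | succ j ih => simp [dig, add_div hQ, ih]

lemma dig_zero (j : ℕ) : dig Q j 0 = 0 := by
  induction j with
  | zero => simp [dig]
  | succ j ih => simp [dig, ih]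

lemma dig_sum (hQ : Q.Monic) (j : ℕ) {ι : Type*} (s : Finset ι) (z : ι → R[X]) :
    dig Q j (∑ i ∈ s, z i) = ∑ i ∈ s, dig Q j (z i) := by
  classical
  induction s using Finset.induction_on with
  | empty => simp [dig_zero]
  | insert a s ha ih => rw [Finset.sum_insert ha, Finset.sum_insert ha, dig_add hQ, ih]

lemma dig_degree (hQ : Q.Monic) (j : ℕ) (a : R[X]) : (dig Q j a).degree < Q.degree := by
  induction j generalizing a with
  | zero => exact degree_modByMonic_lt _ hQ
  | succ j ih => exact ih _

lemma dig_mul_pow (hQ : Q.Monic) (j i : ℕ) (B : R[X]) (hB : B.degree < Q.degree) :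
    dig Q j (B * Q ^ i) = if i = j then B else 0 := by
  induction j generalizing i with
  | zero =>
    cases i with
    | zero => simpa [dig] using (modByMonic_eq_self_iff hQ).2 hB
    | succ i =>
      simp only [dig]
      rw [if_neg (by simp), modByMonic_eq_zero_iff_dvd hQ]
      exact ⟨B * Q ^ i, by ring⟩
  | succ j ih =>
    simp only [dig]
    cases i with
    | zero => simp [(divByMonic_eq_zero_iff hQ).2 hB, dig_zero]
    | succ i =>
      have : (B * Q ^ (i + 1)) /ₘ Q = B * Q ^ i := by
        rw [show B * Q ^ (i + 1) = Q * (B * Q ^ i) by ring, mul_divByMonic_cancel_left _ hQ]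
      rw [this, ih]; simp

lemma dig_expand (hQ : Q.Monic) (N : ℕ) (H : R[X]) (h : H.degree < (Q.natDegree * N : ℕ)) :
    H = ∑ j ∈ Finset.range N, dig Q j H * Q ^ j := by
  induction N generalizing H with
  | zero => simpa using h
  | succ N ih =>
    rw [Finset.sum_range_succ']
    have h2 : (H /ₘ Q).degree < (Q.natDegree * N : ℕ) := by
      by_cases h0 : H /ₘ Q = 0
      · rw [h0, degree_zero]; exact WithBot.bot_lt_coe _
      · have hle : Q.degree ≤ H.degree := by
          by_contra hc; exact h0 ((divByMonic_eq_zero_iff hQ).2 (not_le.1 hc))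
        have h3 := degree_add_divByMonic hQ hle
        rw [← h3, degree_eq_natDegree hQ.ne_zero, degree_eq_natDegree h0] at h
        rw [degree_eq_natDegree h0]
        norm_cast at h ⊢
        rw [mul_add] at h; omega
    conv_lhs => rw [← modByMonic_add_div H Q, ih _ h2]
    simp only [dig, pow_zero, mul_one, Finset.mul_sum]
    rw [add_comm]
    congr 1
    apply Finset.sum_congr rfl
    intros; ring
end dig

end AMS

end

section
open Polynomial
namespace AMS
variable {F : Type*} [Field F] {n : ℕ}

namespace DVal
variable (V : DVal F n)

def Chain (V : DVal F n) (e d : ℕ) : Prop :=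
  e * d = n ∧ ∀ H : F[X], H ≠ 0 → H.degree < e → ∃ z : ℤ, V.v H = ((d * z : ℤ) : WithBot ℤ)

structure Good (V : DVal F n) (e d : ℕ) (Q : F[X]) (δ : ℤ) : Prop where
  monic : Q.Monic
  deg : Q.natDegree = e
  val : V.v Q = δ
  ndvd : ¬ (d : ℤ) ∣ δ

variable {V}

lemma Good.degree {e d : ℕ} {Q : F[X]} {δ : ℤ} (hQ : V.Good e d Q δ) : Q.degree = e := by
  rw [degree_eq_natDegree hQ.monic.ne_zero, hQ.deg]

lemma term_val {e d : ℕ} (hc : V.Chain e d) {Q : F[X]} {δ : ℤ} (hv : V.v Q = δ) (B : F[X])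
    (hB : B.degree < e) (hB0 : B ≠ 0) (j : ℕ) :
    ∃ z : ℤ, V.v (B * Q ^ j) = ((d * z + j * δ : ℤ) : WithBot ℤ) := by
  obtain ⟨z, hz⟩ := hc.2 B hB0 hB
  exact ⟨z, by rw [V.v_mul, hz, V.v_pow hv, ← WithBot.coe_add]⟩

/-- order data -/
def Ord (d r d' : ℕ) (δ : ℤ) : Prop :=
  d = r * d' ∧ (d' : ℤ) ∣ δ ∧ ∀ k : ℤ, (d : ℤ) ∣ k * δ → (r : ℤ) ∣ k

lemma exists_ord (d : ℕ) (hd : 0 < d) (δ : ℤ) : ∃ r d', Ord d r d' δ := by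
  refine ⟨d / Nat.gcd d δ.natAbs, Nat.gcd d δ.natAbs, ?_, ?_, ?_⟩
  · exact (Nat.div_mul_cancel (Nat.gcd_dvd_left _ _)).symm
  · exact Int.natCast_dvd.2 (Nat.gcd_dvd_right _ _)
  · intro k hk
    rw [Int.natCast_dvd, Int.natAbs_mul] at hk
    rw [Int.natCast_dvd]
    have hg : 0 < Nat.gcd d δ.natAbs := Nat.gcd_pos_of_pos_left _ hd
    have hco := Nat.coprime_div_gcd_div_gcd hg
    refine hco.dvd_of_dvd_mul_right ?_
    obtain ⟨a, ha⟩ := Nat.gcd_dvd_left d δ.natAbs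
    obtain ⟨b, hb⟩ := Nat.gcd_dvd_right d δ.natAbs
    generalize Nat.gcd d δ.natAbs = g at *
    rw [ha, hb] at hk ⊢
    rw [Nat.mul_div_cancel_left _ hg, Nat.mul_div_cancel_left _ hg]
    have : g * a ∣ g * (k.natAbs * b) := by convert hk using 1; ring
    exact Nat.dvd_of_mul_dvd_mul_left hg this

lemma term_inj {e d r d' : ℕ} (hc : V.Chain e d) {Q : F[X]} {δ : ℤ} (hv : V.v Q = δ)
    (ho : Ord d r d' δ) (B : ℕ → F[X]) (hB : ∀ j, (B j).degree < e) :
    ∀ i ∈ Finset.range r, ∀ j ∈ Finset.range r, V.v (B i * Q ^ i) = V.v (B j * Q ^ j) →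
      V.v (B i * Q ^ i) = ⊥ ∨ i = j := by
  intro i hi j hj h
  by_cases hi0 : B i = 0
  · left; simp [hi0, V.v_zero]
  by_cases hj0 : B j = 0
  · left; rw [h]; simp [hj0, V.v_zero]
  right
  obtain ⟨z, hz⟩ := term_val hc hv _ (hB i) hi0 i
  obtain ⟨w, hw⟩ := term_val hc hv _ (hB j) hj0 j
  rw [hz, hw, WithBot.coe_inj] at h
  have h1 : (r : ℤ) ∣ ((i : ℤ) - j) := ho.2.2 _ ⟨w - z, by linear_combination h⟩
  rw [Finset.mem_range] at hi hj
  have h2 : ((i : ℤ) - j) = 0 := by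
    apply Int.eq_zero_of_abs_lt_dvd h1
    rw [abs_lt]; constructor <;> omega
  omega

lemma v_expand {e d r d' : ℕ} (hc : V.Chain e d) {Q : F[X]} {δ : ℤ} (hQ : V.Good e d Q δ)
    (ho : Ord d r d' δ) (H : F[X]) (hH : H.degree < (e * r : ℕ)) :
    V.v H = (Finset.range r).sup (fun j => V.v (dig Q j H * Q ^ j)) := by
  have h1 := dig_expand hQ.monic r H (by rwa [hQ.deg])
  conv_lhs => rw [h1]
  apply V.v_sum
  apply term_inj hc hQ.val ho (fun j => dig Q j H)
  intro j
  have := dig_degree hQ.monic j H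
  rwa [hQ.degree] at this

lemma v_expand_exists {e d r d' : ℕ} (hc : V.Chain e d) {Q : F[X]} {δ : ℤ} (hQ : V.Good e d Q δ)
    (ho : Ord d r d' δ) (H : F[X]) (hH : H.degree < (e * r : ℕ)) (h0 : H ≠ 0) :
    ∃ j < r, dig Q j H ≠ 0 ∧ V.v H = V.v (dig Q j H * Q ^ j) ∧ V.v H ≠ ⊥ := by
  have h1 := dig_expand hQ.monic r H (by rwa [hQ.deg])
  have hex : ∃ j ∈ Finset.range r, dig Q j H ≠ 0 := by
    by_contra hcon
    push Not at hcon
    apply h0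
    rw [h1]
    exact Finset.sum_eq_zero (fun j hj => by rw [hcon j hj, zero_mul])
  obtain ⟨j, hj, hj0⟩ := hex
  have hd : ∀ j, (dig Q j H).degree < e := fun j => by
    have := dig_degree hQ.monic j H
    rwa [hQ.degree] at this
  have hne : V.v H ≠ ⊥ := by
    rw [v_expand hc hQ ho H hH]
    intro hb
    rw [Finset.sup_eq_bot_iff] at hb
    have := hb j hj
    obtain ⟨z, hz⟩ := term_val hc hQ.val _ (hd j) hj0 j
    rw [hz] at this
    exact WithBot.coe_ne_bot this
  obtain ⟨i, hi, he⟩ := Finset.exists_mem_eq_sup (Finset.range r) ⟨j, hj⟩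
    (fun j => V.v (dig Q j H * Q ^ j))
  rw [← v_expand hc hQ ho H hH] at he
  refine ⟨i, Finset.mem_range.1 hi, ?_, he, hne⟩
  intro hz
  simp only [hz, zero_mul, V.v_zero] at he
  exact hne he

lemma chain_next {e d r d' : ℕ} (hc : V.Chain e d) {Q : F[X]} {δ : ℤ} (hQ : V.Good e d Q δ)
    (ho : Ord d r d' δ) : V.Chain (e * r) d' := by
  refine ⟨by rw [mul_assoc, ← ho.1, hc.1], ?_⟩
  intro H h0 hH
  obtain ⟨j, hj, hj0, he, -⟩ := v_expand_exists hc hQ ho H hH h0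
  have hd := dig_degree hQ.monic j H
  rw [hQ.degree] at hd
  obtain ⟨z, hz⟩ := term_val hc hQ.val _ hd hj0 j
  obtain ⟨w, hw⟩ := ho.2.1
  refine ⟨r * z + j * w, ?_⟩
  rw [he, hz, WithBot.coe_inj, ho.1, hw]; push_cast; ring

lemma chain_one (V : DVal F n) : V.Chain 1 n := by
  refine ⟨one_mul n, ?_⟩
  intro H h0 hH
  have : H.natDegree = 0 := by
    rw [degree_eq_natDegree h0] at hH
    norm_cast at hH; omega
  rw [eq_C_of_natDegree_eq_zero this] at h0 ⊢
  exact V.v_C _ (by simpa using h0)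

/-- residues -/
def Res (V : DVal F n) (j : ℕ) : Set (ZMod n) :=
  {z | ∃ H : F[X], H.degree < j ∧ ∃ k : ℤ, V.v H = k ∧ (k : ZMod n) = z}

lemma v_smul (V : DVal F n) (a : F) (ha : a ≠ 0) (H : F[X]) (k : ℤ) (h : V.v H = k) :
    ∃ k' : ℤ, V.v (C a * H) = k' ∧ (n : ℤ) ∣ k' - k := by
  obtain ⟨z, hz⟩ := V.v_C a ha
  exact ⟨n * z + k, by rw [V.v_mul, hz, h, WithBot.coe_add], ⟨z, by ring⟩⟩

lemma res_succ (V : DVal F n) (j : ℕ) : ∃ z, V.Res (j + 1) ⊆ insert z (V.Res j) := by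
  by_cases hsub : V.Res (j + 1) ⊆ V.Res j
  · exact ⟨0, hsub.trans (Set.subset_insert _ _)⟩
  rw [Set.not_subset] at hsub
  obtain ⟨z, ⟨H, hH, k, hk, hkz⟩, hz⟩ := hsub
  refine ⟨z, ?_⟩
  rintro u ⟨H', hH', k', hk', hku⟩
  by_contra hcon
  rw [Set.mem_insert_iff, not_or] at hcon
  have hdeg : ∀ G : F[X], G.degree < (j + 1 : ℕ) → ¬ G.degree < j → G.degree = j := by
    intro G h1 h2
    have h3 : G ≠ 0 := by rintro rfl; exact h2 (by rw [degree_zero]; exact WithBot.bot_lt_coe _)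
    rw [degree_eq_natDegree h3] at h1 h2 ⊢
    norm_cast at h1 h2 ⊢
    omega
  have hHj := hdeg H hH (fun hh => hz ⟨H, hh, k, hk, hkz⟩)
  have hHj' := hdeg H' hH' (fun hh => hcon.2 ⟨H', hh, k', hk', hku⟩)
  have h0 : H ≠ 0 := by rintro rfl; simp at hHj
  have h0' : H' ≠ 0 := by rintro rfl; simp at hHj'
  set a := - (H'.leadingCoeff / H.leadingCoeff) with ha
  have hane : a ≠ 0 := by
    rw [ha, neg_ne_zero]
    exact div_ne_zero (leadingCoeff_ne_zero.2 h0') (leadingCoeff_ne_zero.2 h0)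
  obtain ⟨k2, hk2, hdv⟩ := V.v_smul a hane H k hk
  have hk2z : (k2 : ZMod n) = z := by
    rw [← hkz]; exact ((ZMod.intCast_eq_intCast_iff_dvd_sub _ _ _).2 hdv).symm
  have hne : k2 ≠ k' := by rintro rfl; exact hcon.1 (hku.symm.trans hk2z)
  have hlt : (H' + C a * H).degree < j := by
    have : (H' - (-(C a * H))).degree < H'.degree := by
      apply degree_sub_lt_left _ h0'
      · simp only [leadingCoeff_neg, leadingCoeff_mul, leadingCoeff_C, ha]
        field_simp [leadingCoeff_ne_zero.2 h0]
      · rw [degree_neg, degree_C_mul hane, hHj, hHj']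
    rwa [sub_neg_eq_add, hHj'] at this
  have hval : V.v (H' + C a * H) = max (k' : WithBot ℤ) k2 := by
    rw [V.v_add_eq, hk', hk2]
    left; rw [hk', hk2]; intro h; exact hne (WithBot.coe_inj.1 h).symm
  rcases le_total k' k2 with h | h
  · rw [max_eq_right (WithBot.coe_le_coe.2 h)] at hval
    exact hz ⟨_, hlt, k2, hval, hk2z⟩
  · rw [max_eq_left (WithBot.coe_le_coe.2 h)] at hval
    exact hcon.2 ⟨_, hlt, k', hval, hku⟩

lemma res_card [NeZero n] (V : DVal F n) (i j : ℕ) : (V.Res (i + j)).ncard ≤ (V.Res i).ncard + j := by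
  induction j with
  | zero => simp
  | succ j ih =>
    obtain ⟨z, hz⟩ := V.res_succ (i + j)
    have h1 := Set.ncard_le_ncard hz (Set.toFinite _)
    have h2 := Set.ncard_insert_le z (V.Res (i + j))
    rw [← add_assoc]; omega

lemma exists_good [NeZero n] (V : DVal F n)
    (hfull : ∀ k < n, ∃ H : F[X], H.degree < n ∧ V.v H = ((k : ℤ) : WithBot ℤ))
    {e d : ℕ} (hc : V.Chain e d) (hd : 1 < d) : ∃ Q δ, V.Good e d Q δ := by
  have hn : 0 < n := Nat.pos_of_ne_zero (NeZero.ne n)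
  have he : 0 < e := by
    rcases Nat.eq_zero_or_pos e with h | h
    · have := hc.1; subst h; omega
    · exact h
  have hen : e + 1 ≤ n := by have := hc.1; nlinarith
  have huniv : V.Res n = Set.univ := by
    ext z
    simp only [Set.mem_univ, iff_true]
    obtain ⟨H, h1, h2⟩ := hfull z.val (ZMod.val_lt z)
    exact ⟨H, h1, _, h2, by simp⟩
  have hcard : e + 1 ≤ (V.Res (e + 1)).ncard := by
    have := V.res_card (e + 1) (n - (e + 1))
    rw [Nat.add_sub_cancel' hen, huniv, Set.ncard_univ, Nat.card_zmod] at this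
    omega
  have hex : ∃ H : F[X], H.degree < (e + 1 : ℕ) ∧ ∃ k : ℤ, V.v H = k ∧ ¬ (d : ℤ) ∣ k := by
    by_contra hcon
    push Not at hcon
    have hsub : V.Res (e + 1) ⊆ (fun i : ℕ => ((d * i : ℕ) : ZMod n)) '' (Finset.range e : Set ℕ) := by
      rintro z ⟨H, hH, k, hk, rfl⟩
      obtain ⟨w, hw⟩ := hcon H hH k hk
      refine ⟨(w % e).toNat, ?_, ?_⟩
      · have h1 := Int.emod_lt_of_pos w (by exact_mod_cast he : (0 : ℤ) < e)
        have h2 := Int.emod_nonneg w (by exact_mod_cast he.ne' : (e : ℤ) ≠ 0)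
        simp only [Finset.coe_range, Set.mem_Iio]; omega
      · have h2 := Int.emod_nonneg w (by exact_mod_cast he.ne' : (e : ℤ) ≠ 0)
        have h3 : (((d * (w % e).toNat : ℕ) : ℤ) : ZMod n) = (k : ZMod n) := by
          rw [ZMod.intCast_eq_intCast_iff_dvd_sub]
          push_cast
          rw [Int.toNat_of_nonneg h2, hw, ← hc.1]
          refine ⟨w / e, ?_⟩
          have := Int.emod_add_mul_ediv w e
          push_cast
          linear_combination (-(d : ℤ)) * this
        rw [Int.cast_natCast] at h3; exact h3
    have h1 := Set.ncard_le_ncard hsub (Set.toFinite _)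
    have h2 := Set.ncard_image_le (f := (fun i : ℕ => ((d * i : ℕ) : ZMod n)))
      (s := (Finset.range e : Set ℕ)) (Set.toFinite _)
    rw [Set.ncard_coe_finset, Finset.card_range] at h2
    omega
  obtain ⟨H, hH, k, hk, hdk⟩ := hex
  have h0 : H ≠ 0 := by rintro rfl; rw [V.v_zero] at hk; exact WithBot.bot_ne_coe hk
  have hnd : ¬ H.degree < e := by
    intro h
    obtain ⟨z, hz⟩ := hc.2 H h0 h
    rw [hz, WithBot.coe_inj] at hk
    exact hdk ⟨z, hk.symm⟩
  have hne : H.natDegree = e := by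
    rw [degree_eq_natDegree h0] at hH hnd
    norm_cast at hH hnd; omega
  have hl := inv_ne_zero (leadingCoeff_ne_zero.2 h0)
  obtain ⟨k', hk', hdv⟩ := V.v_smul H.leadingCoeff⁻¹ hl H k hk
  refine ⟨C H.leadingCoeff⁻¹ * H, k', ?_, ?_, hk', ?_⟩
  · rw [mul_comm]; exact monic_mul_leadingCoeff_inv h0
  · rw [natDegree_C_mul hl, hne]
  · intro h
    apply hdk
    have h3 : (d : ℤ) ∣ n := by rw [← hc.1]; push_cast; exact dvd_mul_left _ _
    have := dvd_sub h (h3.trans hdv)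
    simpa using this

end DVal
end AMS

end

section
open Polynomial
namespace AMS
variable {F : Type*} [Field F] {n : ℕ}

lemma wb_le_sub {x : WithBot ℤ} {a c : ℤ} (h : x + (a : WithBot ℤ) ≤ (c : WithBot ℤ)) :
    x ≤ ((c - a : ℤ) : WithBot ℤ) := by
  induction x using WithBot.recBotCoe with
  | bot => exact bot_le
  | coe x =>
    rw [← WithBot.coe_add, WithBot.coe_le_coe] at h
    rw [WithBot.coe_le_coe]; linarith

namespace DVal
variable {V : DVal F n}

def M (V : DVal F n) (Q : F[X]) (δ c : ℤ) (H : F[X]) : Prop :=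
  ∀ j : ℕ, V.v (dig Q j H) ≤ ((c - j * δ : ℤ) : WithBot ℤ)

section
variable {e d : ℕ} {Q : F[X]} {δ : ℤ}

lemma M_mono {c c' : ℤ} {H : F[X]} (h : V.M Q δ c H) (hcc : c ≤ c') : V.M Q δ c' H := fun j =>
  (h j).trans (WithBot.coe_le_coe.2 (by linarith))

lemma M_add (hQ : V.Good e d Q δ) {c : ℤ} {H H' : F[X]} (h : V.M Q δ c H) (h' : V.M Q δ c H') :
    V.M Q δ c (H + H') := fun j => by
  rw [dig_add hQ.monic]
  exact (V.v_add _ _).trans (max_le (h j) (h' j))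

lemma M_sum (hQ : V.Good e d Q δ) {c : ℤ} {ι : Type*} (s : Finset ι) (z : ι → F[X])
    (h : ∀ i ∈ s, V.M Q δ c (z i)) : V.M Q δ c (∑ i ∈ s, z i) := fun j => by
  rw [dig_sum hQ.monic]
  exact V.v_sum_le _ _ _ (fun i hi => h i hi j)

lemma M_gen (hQ : V.Good e d Q δ) {c : ℤ} (i : ℕ) (B : F[X]) (hB : B.degree < e)
    (hv : V.v B ≤ ((c - i * δ : ℤ) : WithBot ℤ)) : V.M Q δ c (B * Q ^ i) := fun j => by
  rw [dig_mul_pow hQ.monic _ _ _ (by rwa [hQ.degree])]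
  split_ifs with h
  · subst h; exact hv
  · rw [V.v_zero]; exact bot_le

lemma M_mul_gen (he : 0 < e) (hc : V.Chain e d) (hQ : V.Good e d Q δ) {a b : ℤ} (i j : ℕ) (B B' : F[X])
    (hB : B.degree < e) (hB' : B'.degree < e)
    (hv : V.v B ≤ ((a - i * δ : ℤ) : WithBot ℤ)) (hv' : V.v B' ≤ ((b - j * δ : ℤ) : WithBot ℤ)) :
    V.M Q δ (a + b) ((B * Q ^ i) * (B' * Q ^ j)) := by
  set c0 := (B * B') %ₘ Q with hc0
  set c1 := (B * B') /ₘ Q with hc1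
  have hsum : c0 + Q * c1 = B * B' := modByMonic_add_div _ _
  have hd0 : c0.degree < e := by
    rw [← hQ.degree]; exact degree_modByMonic_lt _ hQ.monic
  have hd1 : c1.degree < e := by
    by_cases h0 : c1 = 0
    · rw [h0, degree_zero]; exact WithBot.bot_lt_coe _
    · have hle : Q.degree ≤ (B * B').degree := by
        by_contra hcon; exact h0 ((divByMonic_eq_zero_iff hQ.monic).2 (not_le.1 hcon))
      have h3 := degree_add_divByMonic hQ.monic hle
      have hBB : B * B' ≠ 0 := by intro hh; apply h0; rw [hc1, hh, zero_divByMonic]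
      have hB0 : B ≠ 0 := left_ne_zero_of_mul hBB
      have hB0' : B' ≠ 0 := right_ne_zero_of_mul hBB
      rw [← hc1, hQ.degree, degree_mul, degree_eq_natDegree h0, degree_eq_natDegree hB0,
        degree_eq_natDegree hB0'] at h3
      rw [degree_eq_natDegree hB0] at hB
      rw [degree_eq_natDegree hB0'] at hB'
      rw [degree_eq_natDegree h0]
      norm_cast at *
      omega
  have hmax : V.v (B * B') = max (V.v c0) (V.v (Q * c1)) := by
    rw [← hsum]
    apply V.v_add_eq
    by_cases h0 : c0 = 0
    · right; rw [h0, V.v_zero]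
    by_cases h1 : c1 = 0
    · left
      obtain ⟨z, hz⟩ := hc.2 c0 h0 hd0
      rw [h1, mul_zero, V.v_zero, hz]
      exact WithBot.coe_ne_bot
    · left
      obtain ⟨z, hz⟩ := hc.2 c0 h0 hd0
      obtain ⟨w, hw⟩ := hc.2 c1 h1 hd1
      rw [V.v_mul, hz, hw, hQ.val, ← WithBot.coe_add]
      intro hh
      rw [WithBot.coe_inj] at hh
      exact hQ.ndvd ⟨z - w, by linear_combination -hh⟩
  have hBB : V.v (B * B') ≤ ((a + b - (i + j : ℕ) * δ : ℤ) : WithBot ℤ) := by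
    rw [V.v_mul]
    refine (add_le_add hv hv').trans ?_
    rw [← WithBot.coe_add, WithBot.coe_le_coe]
    push_cast; linarith
  have hle0 := (le_max_left _ _).trans (hmax.symm.le.trans hBB)
  have hle1 := (le_max_right _ _).trans (hmax.symm.le.trans hBB)
  have : (B * Q ^ i) * (B' * Q ^ j) = c0 * Q ^ (i + j) + c1 * Q ^ (i + j + 1) := by
    rw [show (B * Q ^ i) * (B' * Q ^ j) = (B * B') * Q ^ (i + j) by ring, ← hsum]; ring
  rw [this]
  refine M_add hQ (M_gen hQ _ _ hd0 hle0) (M_gen hQ _ _ hd1 ?_)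
  rw [V.v_mul, hQ.val, add_comm] at hle1
  refine (wb_le_sub hle1).trans (WithBot.coe_le_coe.2 ?_)
  push_cast; linarith

lemma expand' (he : 0 < e) (hQ : V.Good e d Q δ) (H : F[X]) :
    ∃ N, H = ∑ j ∈ Finset.range N, dig Q j H * Q ^ j := by
  refine ⟨H.natDegree + 1, dig_expand hQ.monic _ _ ?_⟩
  refine degree_le_natDegree.trans_lt ?_
  rw [hQ.deg]
  norm_cast
  nlinarith

lemma M_mul (he : 0 < e) (hc : V.Chain e d) (hQ : V.Good e d Q δ) {a b : ℤ} {H H' : F[X]}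
    (h : V.M Q δ a H) (h' : V.M Q δ b H') : V.M Q δ (a + b) (H * H') := by
  obtain ⟨N, hN⟩ := expand' he hQ H
  obtain ⟨N', hN'⟩ := expand' he hQ H'
  have hd : ∀ G j, (dig Q j G).degree < e := fun G j => by
    rw [← hQ.degree]; exact dig_degree hQ.monic j G
  rw [hN, hN', Finset.sum_mul_sum]
  refine M_sum hQ _ _ (fun i _ => M_sum hQ _ _ (fun j _ => ?_))
  exact M_mul_gen he hc hQ i j _ _ (hd _ _) (hd _ _) (h i) (h' j)

lemma M_Qpow (he : 0 < e) (hQ : V.Good e d Q δ) (k : ℕ) : V.M Q δ (k * δ) (Q ^ k) := by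
  have := M_gen (c := k * δ) hQ k 1 (by rw [degree_one]; exact_mod_cast he) (by rw [V.v_one]; simp)
  rwa [one_mul] at this

lemma M_pow (he : 0 < e) (hc : V.Chain e d) (hQ : V.Good e d Q δ) {a : ℤ} {H : F[X]}
    (h : V.M Q δ a H) (k : ℕ) : V.M Q δ (k * a) (H ^ k) := by
  induction k with
  | zero => simpa using M_Qpow he hQ 0
  | succ k ih =>
    rw [pow_succ]
    refine M_mono (M_mul he hc hQ ih h) ?_
    push_cast; linarith

lemma M_of_lt {r d' : ℕ} (hc : V.Chain e d) (hQ : V.Good e d Q δ)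
    (ho : Ord d r d' δ) (H : F[X]) (hH : H.degree < (e * r : ℕ)) {c : ℤ}
    (hv : V.v H ≤ (c : WithBot ℤ)) : V.M Q δ c H := by
  have h1 := dig_expand hQ.monic r H (by rwa [hQ.deg])
  rw [h1]
  refine M_sum hQ _ _ (fun j hj => M_gen hQ j _ ?_ ?_)
  · rw [← hQ.degree]; exact dig_degree hQ.monic j _
  · apply wb_le_sub
    rw [← V.v_pow hQ.val, ← V.v_mul]
    refine le_trans ?_ hv
    rw [v_expand hc hQ ho H hH]
    exact Finset.le_sup (f := fun j => V.v (dig Q j H * Q ^ j)) hj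

end

lemma ord_lt {d r d' : ℕ} {δ : ℤ} (hd : 1 < d) (ho : Ord d r d' δ) (hn : ¬ (d : ℤ) ∣ δ) :
    2 ≤ r ∧ 0 < d' ∧ d' < d := by
  obtain ⟨h1, h2, -⟩ := ho
  have hd' : 0 < d' := by
    rcases Nat.eq_zero_or_pos d' with h | h
    · subst h; omega
    · exact h
  have hr : 2 ≤ r := by
    rcases r with _ | _ | r
    · omega
    · exfalso; apply hn; rw [h1]; simpa using h2
    · omega
  exact ⟨hr, hd', by nlinarith⟩

theorem M_P [NeZero n] (V : DVal F n)
    (hfull : ∀ k < n, ∃ H : F[X], H.degree < n ∧ V.v H = ((k : ℤ) : WithBot ℤ))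
    (P : F[X]) (hP : P.Monic) (hPn : P.natDegree = n) (hPv : V.v P = ⊥) :
    ∀ (d e : ℕ) (Q : F[X]) (δ : ℤ), V.Chain e d → 1 < d → V.Good e d Q δ → V.M Q δ (d * δ) P := by
  intro d
  induction d using Nat.strong_induction_on with
  | _ d ih =>
  intro e Q δ hc hd hQ
  have hn : 0 < n := Nat.pos_of_ne_zero (NeZero.ne n)
  have he : 0 < e := by
    rcases Nat.eq_zero_or_pos e with h | h
    · have := hc.1; subst h; omega
    · exact h
  obtain ⟨r, d', ho⟩ := exists_ord d (by omega) δ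
  obtain ⟨hr, hd', hlt⟩ := ord_lt hd ho hQ.ndvd
  have hc' := chain_next hc hQ ho
  have hQr : (Q ^ r).Monic := hQ.monic.pow r
  have hQrn : (Q ^ r).natDegree = e * r := by rw [hQ.monic.natDegree_pow, hQ.deg, mul_comm]
  have hdl : ∀ T : F[X], T.Monic → T.natDegree = e * r → (T - Q ^ r).degree < (e * r : ℕ) := by
    intro T hT hTn
    have hTd : T.degree = (e * r : ℕ) := by rw [degree_eq_natDegree hT.ne_zero, hTn]
    rw [← hTd]
    apply degree_sub_lt_left _ hT.ne_zero
    · rw [hT.leadingCoeff, hQr.leadingCoeff]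
    · rw [hTd, degree_eq_natDegree hQr.ne_zero, hQrn]
  -- a monic polynomial of degree e*r with small value lies in M
  have key : ∀ T : F[X], T.Monic → T.natDegree = e * r → V.v T ≤ ((r * δ : ℤ) : WithBot ℤ) →
      V.M Q δ (r * δ) T := by
    intro T hT hTn hTv
    have h1 : V.v (T - Q ^ r) ≤ ((r * δ : ℤ) : WithBot ℤ) := by
      rw [sub_eq_add_neg]
      refine (V.v_add _ _).trans (max_le hTv ?_)
      rw [V.v_neg, V.v_pow hQ.val]
    have := M_add hQ (M_of_lt hc hQ ho _ (hdl T hT hTn) h1) (M_Qpow he hQ r)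
    simpa using this
  rcases Nat.lt_or_ge 1 d' with h1 | h1
  · obtain ⟨Q', δ', hQ'⟩ := exists_good V hfull hc' h1
    have hM := ih d' hlt (e * r) Q' δ' hc' h1 hQ'
    have hδ : δ' ≤ r * δ := by
      have hD := hdl Q' hQ'.monic hQ'.deg
      have hmx : V.v (-(Q' - Q ^ r) + Q') = max (V.v (-(Q' - Q ^ r))) (V.v Q') := by
        apply V.v_add_eq
        rw [V.v_neg]
        by_cases h0 : Q' - Q ^ r = 0
        · right; rw [h0, V.v_zero]
        · left
          obtain ⟨z, hz⟩ := hc'.2 _ h0 hD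
          rw [hz, hQ'.val]
          intro hh
          rw [WithBot.coe_inj] at hh
          exact hQ'.ndvd ⟨z, hh.symm⟩
      rw [show -(Q' - Q ^ r) + Q' = Q ^ r by ring, V.v_pow hQ.val, hQ'.val] at hmx
      exact WithBot.coe_le_coe.1 ((le_max_right _ _).trans hmx.symm.le)
    have hQ'M := key Q' hQ'.monic hQ'.deg (by rw [hQ'.val]; exact WithBot.coe_le_coe.2 hδ)
    have hexp := dig_expand hQ'.monic (d' + 1) P (by
      rw [degree_eq_natDegree hP.ne_zero, hPn, hQ'.deg]
      norm_cast
      have h5 := hc'.1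
      have h6 : 0 < e * r := Nat.mul_pos he (by omega)
      rw [mul_add]; omega)
    rw [hexp]
    refine M_sum hQ _ _ (fun j hj => ?_)
    rw [Finset.mem_range] at hj
    have hA := M_of_lt hc hQ ho (dig Q' j P) (by rw [← hQ'.degree]; exact dig_degree hQ'.monic j _) (hM j)
    refine M_mono (M_mul he hc hQ hA (M_pow he hc hQ hQ'M j)) ?_
    have hd2 : (d : ℤ) = r * d' := by exact_mod_cast ho.1
    have hj' : (0 : ℤ) ≤ d' - j := by omega
    rw [hd2]
    nlinarith [mul_nonneg hj' (sub_nonneg.2 hδ)]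
  · have hd1 : d' = 1 := by omega
    subst hd1
    have hrd : d = r := by simpa using ho.1
    rw [hrd]
    apply key P hP
    · rw [hPn, ← hc'.1, mul_one]
    · rw [hPv]; exact bot_le

end DVal
end AMS

end

section
open Polynomial
namespace AMS

section approx
variable {R : Type*} [CommRing R] [IsDomain R]

lemma geom_natDegree {X Y : R[X]} {e : ℕ} (hX : X.natDegree ≤ e) (hY : Y.natDegree ≤ e) (k : ℕ) :
    (∑ i ∈ Finset.range k, X ^ i * Y ^ (k - 1 - i)).natDegree ≤ e * (k - 1) := by
  apply natDegree_sum_le_of_forall_le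
  intro i hi
  rw [Finset.mem_range] at hi
  refine natDegree_mul_le.trans ?_
  have h1 : (X ^ i).natDegree ≤ i * e := natDegree_pow_le.trans (Nat.mul_le_mul_left _ hX)
  have h2 : (Y ^ (k - 1 - i)).natDegree ≤ (k - 1 - i) * e :=
    natDegree_pow_le.trans (Nat.mul_le_mul_left _ hY)
  calc _ ≤ i * e + (k - 1 - i) * e := add_le_add h1 h2
    _ = e * (k - 1) := by rw [← add_mul, mul_comm]; congr 1; omega

lemma pow_sub_natDegree {X Y : R[X]} {e b : ℕ} (hX : X.natDegree ≤ e) (hY : Y.natDegree ≤ e)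
    (hb : (X - Y).natDegree ≤ b) (k : ℕ) : (X ^ k - Y ^ k).natDegree ≤ b + e * (k - 1) := by
  rw [← (Commute.all X Y).geom_sum₂_mul, mul_comm]
  exact natDegree_mul_le.trans (add_le_add hb (geom_natDegree hX hY k))

lemma monic_add_small {H B : R[X]} {e : ℕ} (hH : H.Monic) (hHe : H.natDegree = e)
    (hB : B.degree < e) : (H + B).Monic ∧ (H + B).natDegree = e := by
  have : B.degree < H.degree := by rwa [degree_eq_natDegree hH.ne_zero, hHe]
  exact ⟨hH.add_of_left this, by rw [natDegree_add_eq_left_of_degree_lt this, hHe]⟩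

lemma tsch {P H : R[X]} {e d : ℕ} (hd : 1 ≤ d) (he : 0 < e) {u : R} (hu : (d : R) * u = 1)
    (hP : P.Monic) (hPn : P.natDegree = e * d) (hH : H.Monic) (hHe : H.natDegree = e)
    (hge : ((e * (d - 1) : ℕ) : WithBot ℕ) ≤ (P - H ^ d).degree) :
    (P - (H + C u * dig H (d - 1) P) ^ d).degree < (P - H ^ d).degree := by
  obtain ⟨d, rfl⟩ : ∃ k, d = k + 1 := ⟨d - 1, by omega⟩
  simp only [Nat.add_sub_cancel] at *
  set B := dig H d P with hBdef
  have hHd : H.degree = e := by rw [degree_eq_natDegree hH.ne_zero, hHe]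
  have hBd : B.degree < e := by rw [← hHd]; exact dig_degree hH _ _
  have hB' : dig H d (P - H ^ (d + 1)) = B := by
    have h1 := dig_add hH d (P - H ^ (d + 1)) (1 * H ^ (d + 1))
    rw [dig_mul_pow hH, if_neg (by omega), one_mul, sub_add_cancel, add_zero] at h1
    · exact h1.symm
    · rw [degree_one, hHd]; exact_mod_cast he
  have hHp : (H ^ (d + 1)).Monic := hH.pow _
  have hlt : (P - H ^ (d + 1)).degree < (e * (d + 1) : ℕ) := by
    have : P.degree = (e * (d + 1) : ℕ) := by rw [degree_eq_natDegree hP.ne_zero, hPn]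
    rw [← this]
    apply degree_sub_lt_left _ hP.ne_zero
    · rw [hP.leadingCoeff, hHp.leadingCoeff]
    · rw [this, degree_eq_natDegree hHp.ne_zero, hH.natDegree_pow, hHe, mul_comm]
  have hexp := dig_expand hH (d + 1) (P - H ^ (d + 1)) (by rwa [hHe])
  rw [Finset.sum_range_succ, hB'] at hexp
  set S := ∑ j ∈ Finset.range d, dig H j (P - H ^ (d + 1)) * H ^ j with hS
  have hSd : S.degree < (e * d : ℕ) := by
    rw [hS]
    refine (degree_sum_le _ _).trans_lt ?_
    rw [Finset.sup_lt_iff (WithBot.bot_lt_coe _)]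
    intro j hj
    rw [Finset.mem_range] at hj
    by_cases h0 : dig H j (P - H ^ (d + 1)) = 0
    · rw [h0, zero_mul, degree_zero]; exact WithBot.bot_lt_coe _
    have h1 := dig_degree hH j (P - H ^ (d + 1))
    rw [hHd, degree_eq_natDegree h0] at h1
    rw [degree_mul, degree_pow, hHd, degree_eq_natDegree h0, nsmul_eq_mul]
    norm_cast at h1 ⊢
    nlinarith
  have hB0 : B ≠ 0 := by
    intro h0
    rw [h0, zero_mul, add_zero] at hexp
    rw [hexp] at hge
    exact absurd hSd (not_lt.2 hge)
  have hbe : B.natDegree < e := by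
    rw [degree_eq_natDegree hB0] at hBd; exact_mod_cast hBd
  have hBH : (B * H ^ d).degree = (B.natDegree + e * d : ℕ) := by
    rw [degree_mul, degree_pow, hHd, degree_eq_natDegree hB0]
    push_cast; rw [nsmul_eq_mul, mul_comm (d : WithBot ℕ)]
  have hdeg : (P - H ^ (d + 1)).degree = (B.natDegree + e * d : ℕ) := by
    rw [hexp, degree_add_eq_right_of_degree_lt, hBH]
    rw [hBH]
    exact hSd.trans_le (by norm_cast; omega)
  have hu0 : u ≠ 0 := by rintro rfl; simp at hu
  set H' := H + C u * B with hH'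
  have huB : (C u * B).degree < e := by rwa [degree_C_mul hu0]
  obtain ⟨hm', hn'⟩ := monic_add_small hH hHe huB
  rw [← hH'] at hm' hn'
  have hg := (Commute.all H' H).geom_sum₂_mul (d + 1)
  have hid : P - H' ^ (d + 1) = S - C u * B *
      (∑ i ∈ Finset.range (d + 1), (H' ^ i - H ^ i) * H ^ (d - i)) := by
    have h3 : ∑ i ∈ Finset.range (d + 1), (H' ^ i - H ^ i) * H ^ (d - i) =
        (∑ i ∈ Finset.range (d + 1), H' ^ i * H ^ (d + 1 - 1 - i)) - (d + 1 : ℕ) * H ^ d := by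
      simp only [sub_mul, Finset.sum_sub_distrib, Nat.add_sub_cancel]
      congr 1
      rw [Finset.sum_congr rfl (g := fun _ => H ^ d), Finset.sum_const, Finset.card_range, nsmul_eq_mul]
      intro i hi
      rw [Finset.mem_range] at hi
      rw [← pow_add]; congr 1; omega
    rw [h3]
    have h4 : H' - H = C u * B := by rw [hH']; ring
    rw [h4] at hg
    have h5 : ((d + 1 : ℕ) : R[X]) * C u = 1 := by
      rw [← C_eq_natCast, ← C_mul, hu, C_1]
    linear_combination hexp + hg - (B * H ^ d) * h5
  have hT : (C u * B * (∑ i ∈ Finset.range (d + 1), (H' ^ i - H ^ i) * H ^ (d - i))).degree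
      < (B.natDegree + e * d : ℕ) := by
    rcases Nat.eq_zero_or_pos d with hd0 | hd0
    · subst hd0; simp only [zero_add, Finset.range_one, Finset.sum_singleton, pow_zero, sub_self,
        zero_mul, mul_zero, degree_zero]; exact WithBot.bot_lt_coe _
    refine degree_le_natDegree.trans_lt ?_
    norm_cast
    have h6 : (∑ i ∈ Finset.range (d + 1), (H' ^ i - H ^ i) * H ^ (d - i)).natDegree ≤
        B.natDegree + e * (d - 1) := by
      apply natDegree_sum_le_of_forall_le
      intro i hi
      rw [Finset.mem_range] at hi
      rcases Nat.eq_zero_or_pos i with h0 | h0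
      · subst h0; simp
      refine natDegree_mul_le.trans ?_
      have h7 := pow_sub_natDegree (b := B.natDegree) hn'.le hHe.le (by
        rw [hH', add_sub_cancel_left]; exact natDegree_C_mul_le _ _) i
      have h8 : (H ^ (d - i)).natDegree ≤ e * (d - i) := by
        rw [hH.natDegree_pow, hHe, mul_comm]
      have h9 : e * (i - 1) + e * (d - i) = e * (d - 1) := by
        rw [← mul_add]; congr 1; omega
      omega
    have h10 : (C u * B).natDegree ≤ B.natDegree := natDegree_C_mul_le _ _
    have h11 : e * (d - 1) + e = e * d := by
      rw [← Nat.mul_succ]; congr 1; omega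
    refine (natDegree_mul_le.trans (add_le_add h10 h6)).trans_lt ?_
    omega
  rw [hdeg, hid]
  refine (degree_sub_le _ _).trans_lt (max_lt ?_ hT)
  exact hSd.trans_le (by norm_cast; omega)

lemma exists_approx {P : R[X]} {e d : ℕ} (hd : 1 ≤ d) (he : 0 < e) {u : R} (hu : (d : R) * u = 1)
    (hP : P.Monic) (hPn : P.natDegree = e * d) (Φ : R[X] → Prop)
    (hΦ : ∀ H : R[X], H.Monic → H.natDegree = e → Φ H → Φ (H + C u * dig H (d - 1) P))
    (H : R[X]) (hH : H.Monic) (hHe : H.natDegree = e) (hΦH : Φ H) :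
    ∃ G : R[X], G.Monic ∧ G.natDegree = e ∧ Φ G ∧ (P - G ^ d).degree < (e * (d - 1) : ℕ) := by
  induction hx : (P - H ^ d).degree using WellFoundedLT.induction generalizing H with
  | _ x ih =>
  by_cases hlt : (P - H ^ d).degree < (e * (d - 1) : ℕ)
  · exact ⟨H, hH, hHe, hΦH, hlt⟩
  have hu0 : u ≠ 0 := by rintro rfl; simp at hu
  have hB : (C u * dig H (d - 1) P).degree < e := by
    rw [degree_C_mul hu0, ← hHe, ← degree_eq_natDegree hH.ne_zero]
    exact dig_degree hH _ _
  obtain ⟨h1, h2⟩ := monic_add_small hH hHe hB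
  have h3 := tsch hd he hu hP hPn hH hHe (not_lt.1 hlt)
  exact ih _ (hx ▸ h3) _ h1 h2 (hΦ H hH hHe hΦH) rfl

lemma approx_unique {P Q G : R[X]} {e d : ℕ} (hd : (d : R) ≠ 0)
    (hQ : Q.Monic) (hQe : Q.natDegree = e) (hG : G.Monic) (hGe : G.natDegree = e)
    (h1 : (P - Q ^ d).degree < (e * (d - 1) : ℕ)) (h2 : (P - G ^ d).degree < (e * (d - 1) : ℕ)) :
    Q = G := by
  by_contra hne
  have h3 : (Q ^ d - G ^ d).degree < (e * (d - 1) : ℕ) := by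
    rw [show Q ^ d - G ^ d = (P - G ^ d) - (P - Q ^ d) by ring]
    exact (degree_sub_le _ _).trans_lt (max_lt h2 h1)
  rw [← (Commute.all Q G).geom_sum₂_mul, degree_mul] at h3
  have hc : (∑ i ∈ Finset.range d, Q ^ i * G ^ (d - 1 - i)).coeff (e * (d - 1)) = d := by
    rw [finsetSum_coeff, Finset.sum_congr rfl (g := fun _ => (1 : R))]
    · simp
    intro i hi
    rw [Finset.mem_range] at hi
    have hm : (Q ^ i * G ^ (d - 1 - i)).Monic := (hQ.pow _).mul (hG.pow _)
    have hnd : (Q ^ i * G ^ (d - 1 - i)).natDegree = e * (d - 1) := by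
      rw [(hQ.pow _).natDegree_mul (hG.pow _), hQ.natDegree_pow, hG.natDegree_pow, hQe, hGe,
        ← add_mul, mul_comm]
      congr 1; omega
    rw [← hnd]; exact hm.coeff_natDegree
  have h4 : ((e * (d - 1) : ℕ) : WithBot ℕ) ≤ (∑ i ∈ Finset.range d, Q ^ i * G ^ (d - 1 - i)).degree :=
    le_degree_of_ne_zero (by rw [hc]; exact hd)
  have h5 : 0 ≤ (Q - G).degree := zero_le_degree_iff.2 (sub_ne_zero.2 hne)
  have h6 := add_le_add h4 h5
  rw [add_zero] at h6
  exact absurd h3 (not_lt.2 h6)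

end approx

section final
variable {F : Type*} [Field F] [CharZero F] {n : ℕ} [NeZero n]
variable {A : Type*} [CommRing A] [IsDomain A] [Algebra ℚ A]

lemma good_poly (V : DVal F n) (ι : A →+* F)
    (hfull : ∀ k < n, ∃ H : F[X], H.degree < n ∧ V.v H = ((k : ℤ) : WithBot ℤ))
    (P : A[X]) (hP : P.Monic) (hPn : P.natDegree = n) (hPv : V.v (P.map ι) = ⊥)
    {e d : ℕ} (hc : V.Chain e d) (hd : 1 < d) :
    ∃ (G : A[X]) (δ : ℤ), G.Monic ∧ G.natDegree = e ∧ V.Good e d (G.map ι) δ := by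
  have hn : 0 < n := Nat.pos_of_ne_zero (NeZero.ne n)
  have he : 0 < e := by
    rcases Nat.eq_zero_or_pos e with h | h
    · have := hc.1; subst h; omega
    · exact h
  have hdF : (d : F) ≠ 0 := by exact_mod_cast (by omega : d ≠ 0)
  -- approximate root over A
  have huA : ((d : A)) * algebraMap ℚ A ((d : ℚ)⁻¹) = 1 := by
    rw [← map_natCast (algebraMap ℚ A) d, ← map_mul, mul_inv_cancel₀, map_one]
    exact_mod_cast (by omega : d ≠ 0)
  obtain ⟨G, hG, hGe, -, hGd⟩ := exists_approx (by omega) he huA hP (by rw [hPn, hc.1]) (fun _ => True)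
    (fun _ _ _ _ => trivial) (X ^ e) (monic_X_pow e) (natDegree_X_pow e) trivial
  -- approximate root over F
  obtain ⟨Q0, δ, hQ0⟩ := V.exists_good hfull hc hd
  have hPm : (P.map ι).Monic := hP.map ι
  have hPmn : (P.map ι).natDegree = n := by rw [hP.natDegree_map, hPn]
  have hvu : V.v (C ((d : F)⁻¹)) = ((0 : ℤ) : WithBot ℤ) := by
    obtain ⟨z, hz⟩ := V.v_C _ (inv_ne_zero hdF)
    have h := V.v_mul (C (d : F)) (C ((d : F)⁻¹))
    rw [← C_mul, mul_inv_cancel₀ hdF, C_1, V.v_one, hz, V.v_nat d (by omega), ← WithBot.coe_add,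
      WithBot.coe_inj] at h
    rw [hz, WithBot.coe_inj]; linarith
  obtain ⟨Q, hQ, hQe, hQv, hQd⟩ := exists_approx (by omega) he (mul_inv_cancel₀ hdF) hPm
    (by rw [hPmn, hc.1]) (fun H => V.v H = δ) (by
      intro H hH hHe hHv
      have hgood : V.Good e d H δ := ⟨hH, hHe, hHv, hQ0.ndvd⟩
      have hM := DVal.M_P V hfull (P.map ι) hPm hPmn hPv d e H δ hc hd hgood (d - 1)
      have hdd := dig_degree hH (d - 1) (P.map ι)
      rw [hgood.degree] at hdd
      set B := dig H (d - 1) (P.map ι)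
      have hBv : V.v (C (d : F)⁻¹ * B) ≤ (δ : WithBot ℤ) := by
        rw [V.v_mul, hvu]
        simp only [WithBot.coe_zero, zero_add]
        refine hM.trans (WithBot.coe_le_coe.2 ?_)
        rw [Nat.cast_sub (by omega)]; push_cast; linarith
      have hBd : (C (d : F)⁻¹ * B).degree < e := by rwa [degree_C_mul (inv_ne_zero hdF)]
      set B' := C (d : F)⁻¹ * B
      by_cases h0 : B' = 0
      · rw [h0, add_zero, hHv]
      obtain ⟨z, hz⟩ := hc.2 B' h0 hBd
      have hlt : V.v B' < V.v H := by
        refine lt_of_le_of_ne (hHv ▸ hBv) ?_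
        rw [hz, hHv]
        intro hh
        rw [WithBot.coe_inj] at hh
        exact hQ0.ndvd ⟨z, hh.symm⟩
      rw [add_comm, V.v_add_of_lt hlt, hHv]) Q0 hQ0.monic hQ0.deg hQ0.val
  have hGm : (P.map ι - (G.map ι) ^ d).degree < (e * (d - 1) : ℕ) := by
    rw [← Polynomial.map_pow, ← Polynomial.map_sub]
    exact degree_map_le.trans_lt hGd
  have heq := approx_unique hdF hQ hQe (hG.map ι) (by rw [hG.natDegree_map, hGe]) hQd hGm
  refine ⟨G, δ, hG, hGe, hG.map ι, by rw [hG.natDegree_map, hGe], heq ▸ hQv, hQ0.ndvd⟩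

lemma semigroup (V : DVal F n) (ι : A →+* F)
    (hfull : ∀ k < n, ∃ H : A[X], H.degree < n ∧ V.v (H.map ι) = ((k : ℤ) : WithBot ℤ))
    (P : A[X]) (hP : P.Monic) (hPn : P.natDegree = n) (hPv : V.v (P.map ι) = ⊥) :
    ∀ (d e : ℕ), V.Chain e d → ∀ k < n, d ∣ k →
      ∃ H : A[X], H.degree < e ∧ V.v (H.map ι) = ((k : ℤ) : WithBot ℤ) := by
  intro d
  induction d using Nat.strong_induction_on with
  | _ d ih =>
  intro e hc k hk hdk
  have hn : 0 < n := Nat.pos_of_ne_zero (NeZero.ne n)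
  have hd0 : 0 < d := by
    rcases Nat.eq_zero_or_pos d with h | h
    · have := hc.1; subst h; omega
    · exact h
  rcases Nat.lt_or_ge 1 d with h1 | h1
  · have hfull' : ∀ k < n, ∃ H : F[X], H.degree < n ∧ V.v H = ((k : ℤ) : WithBot ℤ) := fun k hk => by
      obtain ⟨H, h2, h3⟩ := hfull k hk
      exact ⟨_, degree_map_le.trans_lt h2, h3⟩
    obtain ⟨G, δ, hG, hGe, hgood⟩ := good_poly V ι hfull' P hP hPn hPv hc h1
    obtain ⟨r, d', ho⟩ := DVal.exists_ord d hd0 δ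
    obtain ⟨hr, hd', hlt⟩ := DVal.ord_lt h1 ho hgood.ndvd
    obtain ⟨H, hHd, hHv⟩ := ih d' hlt (e * r) (DVal.chain_next hc hgood ho) k hk
      ((Dvd.intro_left r ho.1.symm).trans hdk)
    have h0 : H.map ι ≠ 0 := by
      intro hh; rw [hh, V.v_zero] at hHv; exact WithBot.bot_ne_coe hHv
    obtain ⟨j, hj, hj0, hv, -⟩ := DVal.v_expand_exists hc hgood ho (H.map ι)
      (degree_map_le.trans_lt hHd) h0
    have hjd := dig_degree hgood.monic j (H.map ι)
    rw [hgood.degree] at hjd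
    obtain ⟨z, hz⟩ := DVal.term_val hc hgood.val _ hjd hj0 j
    have hjz : j = 0 := by
      rw [hv, hz, WithBot.coe_inj] at hHv
      obtain ⟨w, hw⟩ := hdk
      have h5 : (r : ℤ) ∣ j := ho.2.2 _ ⟨w - z, by
        have : (k : ℤ) = d * w := by exact_mod_cast hw
        linear_combination hHv + this⟩
      exact Nat.eq_zero_of_dvd_of_lt (Int.natCast_dvd_natCast.1 h5) hj
    subst hjz
    refine ⟨H %ₘ G, ?_, ?_⟩
    · rw [← hGe, ← degree_eq_natDegree hG.ne_zero]; exact degree_modByMonic_lt _ hG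
    · rw [map_modByMonic ι hG, ← hHv, hv, pow_zero, mul_one]; rfl
  · have hd1 : d = 1 := by omega
    subst hd1
    have : e = n := by rw [← hc.1, mul_one]
    rw [this]; exact hfull k hk

theorem core (V : DVal F n) (ι : A →+* F)
    (hfull : ∀ k < n, ∃ H : A[X], H.degree < n ∧ V.v (H.map ι) = ((k : ℤ) : WithBot ℤ))
    (P : A[X]) (hP : P.Monic) (hPn : P.natDegree = n) (hPv : V.v (P.map ι) = ⊥)
    (hA : ∀ a : A, ∀ z : ℤ, V.v (C (ι a)) = z → 0 ≤ z)
    (m : ℕ) (hm : 0 < m) (hX : V.v X = ((m : ℤ) : WithBot ℤ)) : n ∣ m ∨ m ∣ n := by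
  by_cases hnm : n ∣ m
  · exact Or.inl hnm
  right
  have hn : 0 < n := Nat.pos_of_ne_zero (NeZero.ne n)
  have hn1 : 1 < n := by
    rcases Nat.lt_or_ge 1 n with h | h
    · exact h
    · exact absurd (by rw [show n = 1 by omega]; exact one_dvd m) hnm
  have hgood : V.Good 1 n X m := ⟨monic_X, natDegree_X, hX, by rwa [Int.natCast_dvd_natCast]⟩
  have hc := V.chain_one
  obtain ⟨r, d', ho⟩ := DVal.exists_ord n hn (m : ℤ)
  obtain ⟨hr, hd', hlt⟩ := DVal.ord_lt hn1 ho hgood.ndvd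
  have hd'm : d' ∣ m := Int.natCast_dvd_natCast.1 ho.2.1
  have hd'n : d' ∣ n := Dvd.intro_left r ho.1.symm
  have hkd : d' ∣ ((r - 1) * m) % n := (Nat.dvd_mod_iff hd'n).2 (hd'm.mul_left _)
  have hkn := Nat.mod_lt ((r - 1) * m) hn
  obtain ⟨H, hHd, hHv⟩ := semigroup V ι hfull P hP hPn hPv d' (1 * r) (DVal.chain_next hc hgood ho) _ hkn hkd
  set k := ((r - 1) * m) % n with hk
  rw [one_mul] at hHd
  have hsum : H.map ι = ∑ j ∈ Finset.range r, C (ι (H.coeff j)) * X ^ j := by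
    conv_lhs => rw [as_sum_range' H r (by
      by_cases h0 : H = 0
      · rw [h0, natDegree_zero]; omega
      · rw [degree_eq_natDegree h0] at hHd; exact_mod_cast hHd)]
    rw [Polynomial.map_sum]
    exact Finset.sum_congr rfl (fun j _ => by rw [map_monomial, C_mul_X_pow_eq_monomial])
  have hCd : ∀ j : ℕ, (C (ι (H.coeff j))).degree < ((1 : ℕ) : WithBot ℕ) := fun j =>
    degree_C_le.trans_lt (by norm_num)
  have hvs := V.v_sum (Finset.range r) (fun j => C (ι (H.coeff j)) * X ^ j)
    (DVal.term_inj hc hX ho (fun j => C (ι (H.coeff j))) hCd)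
  rw [← hsum, hHv] at hvs
  obtain ⟨j, hj, he⟩ := Finset.exists_mem_eq_sup (Finset.range r) ⟨0, by simp; omega⟩
    (fun j => V.v (C (ι (H.coeff j)) * X ^ j))
  rw [← hvs] at he
  have h0 : C (ι (H.coeff j)) ≠ 0 := by
    intro hz; simp only [hz, zero_mul, V.v_zero] at he; exact WithBot.coe_ne_bot he
  obtain ⟨z, hz⟩ := hc.2 _ h0 (hCd j)
  have hz0 := hA _ _ hz
  rw [V.v_mul, hz, V.v_pow hX, ← WithBot.coe_add, WithBot.coe_inj] at he
  rw [Finset.mem_range] at hj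
  have hkm : (n : ℤ) * (((r - 1) * m : ℕ) / n : ℕ) + k = ((r - 1 : ℕ) : ℤ) * m := by
    exact_mod_cast Nat.div_add_mod ((r - 1) * m) n
  have hdv : (r : ℤ) ∣ ((r - 1 : ℕ) : ℤ) - j := ho.2.2 _
    ⟨z + (((r - 1) * m : ℕ) / n : ℕ), by linear_combination he - hkm⟩
  have hjr : j = r - 1 := by
    have : ((r - 1 : ℕ) : ℤ) - j = 0 := by
      apply Int.eq_zero_of_abs_lt_dvd hdv
      rw [abs_lt]; constructor <;> omega
    omega
  subst hjr
  have hle : (r - 1) * m < n := by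
    have : (((r - 1 : ℕ) * m : ℕ) : ℤ) < n := by push_cast; have : (k : ℤ) < n := by exact_mod_cast hkn
                                                 linarith
    exact_mod_cast this
  obtain ⟨m', hm'⟩ := hd'm
  have hnr := ho.1
  have hm1 : m' = 1 := by
    rcases m' with _ | _ | m'
    · omega
    · rfl
    · exfalso
      obtain ⟨s, rfl⟩ : ∃ s, r = s + 2 := ⟨r - 2, by omega⟩
      rw [hm', hnr] at hle
      simp only [show s + 2 - 1 = s + 1 by omega] at hle
      nlinarith [Nat.zero_le (s * d' * m'), Nat.zero_le (d' * m'), Nat.zero_le (s * d')]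
  rw [hm', hm1, mul_one]; exact hd'n

end final
end AMS

end

section
open Polynomial
namespace AMS

noncomputable def vE (x : RatFunc ℂ) : WithBot ℤ :=
  open Classical in if x = 0 then ⊥ else ((x.intDegree : ℤ) : WithBot ℤ)

lemma vE_zero : vE 0 = ⊥ := by simp [vE]
lemma vE_ne {x : RatFunc ℂ} (h : x ≠ 0) : vE x = ((x.intDegree : ℤ) : WithBot ℤ) := by simp [vE, h]

lemma vE_mul (x y : RatFunc ℂ) : vE (x * y) = vE x + vE y := by
  by_cases hx : x = 0
  · simp [hx, vE_zero]
  by_cases hy : y = 0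
  · simp [hy, vE_zero]
  rw [vE_ne hx, vE_ne hy, vE_ne (mul_ne_zero hx hy), RatFunc.intDegree_mul hx hy, WithBot.coe_add]

lemma vE_add (x y : RatFunc ℂ) : vE (x + y) ≤ max (vE x) (vE y) := by
  by_cases hx : x = 0
  · simp [hx]
  by_cases hy : y = 0
  · simp [hy]
  by_cases hxy : x + y = 0
  · simp [hxy, vE_zero]
  rw [vE_ne hx, vE_ne hy, vE_ne hxy]
  exact_mod_cast RatFunc.intDegree_add_le hy hxy

lemma vE_neg (x : RatFunc ℂ) : vE (-x) = vE x := by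
  by_cases hx : x = 0
  · simp [hx]
  rw [vE_ne hx, vE_ne (neg_ne_zero.2 hx), RatFunc.intDegree_neg]

lemma vE_poly {p : ℂ[X]} (hp : p ≠ 0) :
    vE (algebraMap ℂ[X] (RatFunc ℂ) p) = ((p.natDegree : ℤ) : WithBot ℤ) := by
  rw [vE_ne (by simpa using hp), RatFunc.intDegree_polynomial]

lemma comp_inj {f : ℂ[X]} (hf : 0 < f.natDegree) {p : ℂ[X]} (hp : p ≠ 0) : p.comp f ≠ 0 := by
  intro h
  rcases comp_eq_zero_iff.1 h with h1 | h1
  · exact hp h1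
  · rw [h1.2, natDegree_C] at hf; exact absurd hf (lt_irrefl _)

lemma inj {f : ℂ[X]} (hf : 0 < f.natDegree) :
    Function.Injective ((algebraMap ℂ[X] (RatFunc ℂ)).comp (compRingHom f)) := by
  rw [injective_iff_map_eq_zero]
  intro p hp
  by_contra h0
  have : algebraMap ℂ[X] (RatFunc ℂ) (p.comp f) = 0 := hp
  exact comp_inj hf h0 (by simpa using this)

noncomputable def phi {f : ℂ[X]} (hf : 0 < f.natDegree) : RatFunc ℂ →+* RatFunc ℂ :=
  IsFractionRing.lift (A := ℂ[X]) (inj hf)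

lemma phi_alg {f : ℂ[X]} (hf : 0 < f.natDegree) (p : ℂ[X]) :
    phi hf (algebraMap ℂ[X] (RatFunc ℂ) p) = algebraMap ℂ[X] (RatFunc ℂ) (p.comp f) :=
  IsFractionRing.lift_algebraMap (inj hf) p

lemma vE_phi {f : ℂ[X]} (hf : 0 < f.natDegree) (a : RatFunc ℂ) (ha : a ≠ 0) :
    vE (phi hf a) = ((f.natDegree * a.intDegree : ℤ) : WithBot ℤ) := by
  obtain ⟨p, q, hq, rfl⟩ := IsFractionRing.div_surjective (A := ℂ[X]) a
  have hq0 : q ≠ 0 := nonZeroDivisors.ne_zero hq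
  have hp0 : p ≠ 0 := by rintro rfl; simp at ha
  have h1 : algebraMap ℂ[X] (RatFunc ℂ) p ≠ 0 := by simpa using hp0
  have h2 : algebraMap ℂ[X] (RatFunc ℂ) q ≠ 0 := by simpa using hq0
  have h3 : algebraMap ℂ[X] (RatFunc ℂ) (p.comp f) ≠ 0 := by simpa using comp_inj hf hp0
  have h4 : algebraMap ℂ[X] (RatFunc ℂ) (q.comp f) ≠ 0 := by simpa using comp_inj hf hq0
  rw [map_div₀, phi_alg, phi_alg, vE_ne (div_ne_zero h3 h4), RatFunc.intDegree_div h3 h4,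
    RatFunc.intDegree_div h1 h2]
  simp only [RatFunc.intDegree_polynomial, natDegree_comp]
  congr 1; push_cast; ring

noncomputable def VV {f : ℂ[X]} (hf : 0 < f.natDegree) (g : ℂ[X]) : DVal (RatFunc ℂ) f.natDegree where
  v H := vE (H.eval₂ (phi hf) (algebraMap ℂ[X] (RatFunc ℂ) g))
  v_zero := by simp [vE_zero]
  v_mul a b := by rw [eval₂_mul, vE_mul]
  v_add a b := by rw [eval₂_add]; exact vE_add _ _
  v_neg a := by rw [eval₂_neg, vE_neg]
  v_C a ha := ⟨a.intDegree, by rw [eval₂_C, vE_phi hf a ha]⟩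
  v_nat d hd := by
    rw [eval₂_C, map_natCast, vE_ne (by exact_mod_cast hd)]
    congr 1
    rw [← map_natCast (RatFunc.C (K := ℂ)) d, RatFunc.intDegree_C]

lemma VV_map {f : ℂ[X]} (hf : 0 < f.natDegree) (g : ℂ[X]) (H : ℂ[X][X]) :
    (VV hf g).v (H.map (algebraMap ℂ[X] (RatFunc ℂ))) =
      vE (algebraMap ℂ[X] (RatFunc ℂ) (H.eval₂ (compRingHom f) g)) := by
  show vE _ = _
  rw [eval₂_map, hom_eval₂]
  congr 2
  exact RingHom.ext (fun p => phi_alg hf p)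

lemma adic {f : ℂ[X]} (hf : 0 < f.natDegree) (h : ℂ[X]) :
    ∃ c : Fin f.natDegree → ℂ[X], h = ∑ j, (c j).comp f * X ^ (j : ℕ) := by
  have hf0 : f ≠ 0 := by rintro rfl; simp at hf
  have small : ∀ r : ℂ[X], r.degree < f.degree →
      r = ∑ j : Fin f.natDegree, (C (r.coeff j)).comp f * X ^ (j : ℕ) := by
    intro r hr
    have h1 : r.natDegree < f.natDegree := by
      by_cases h0 : r = 0
      · rw [h0, natDegree_zero]; exact hf
      · exact natDegree_lt_natDegree h0 hr
    conv_lhs => rw [as_sum_range_C_mul_X_pow' r h1]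
    rw [Finset.sum_range]
    simp
  induction hk : h.natDegree using Nat.strong_induction_on generalizing h with
  | _ k ih =>
  by_cases hlt : h.degree < f.degree
  · exact ⟨_, small h hlt⟩
  have hh0 : h ≠ 0 := by
    rintro rfl; apply hlt; rw [degree_zero]; exact bot_lt_iff_ne_bot.2 (degree_eq_bot.not.2 hf0)
  have hdiv : (h / f).natDegree < h.natDegree := by
    have h5 := degree_add_div hf0 (not_lt.1 hlt)
    have h6 : h / f ≠ 0 := by
      intro h7
      rw [h7, degree_zero, WithBot.add_bot] at h5
      exact hh0 (degree_eq_bot.1 h5.symm)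
    rw [degree_eq_natDegree hf0, degree_eq_natDegree h6, degree_eq_natDegree hh0] at h5
    have h8 : f.natDegree + (h / f).natDegree = h.natDegree := by exact_mod_cast h5
    omega
  obtain ⟨c, hc⟩ := ih _ (hk ▸ hdiv) (h / f) rfl
  refine ⟨fun j => X * c j + C ((h % f).coeff j), ?_⟩
  have h2 := small (h % f) (degree_mod_lt h hf0)
  have h3 := EuclideanDomain.div_add_mod h f
  conv_lhs => rw [← h3, hc, h2, Finset.mul_sum, ← Finset.sum_add_distrib]
  refine Finset.sum_congr rfl (fun j _ => ?_)
  simp only [add_comp, mul_comp, X_comp]; ring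

lemma exists_P {f : ℂ[X]} (hf : 0 < f.natDegree) (g : ℂ[X]) :
    ∃ P : ℂ[X][X], P.Monic ∧ P.natDegree = f.natDegree ∧ P.eval₂ (compRingHom f) g = 0 := by
  choose c hc using fun i : Fin f.natDegree => adic hf (g * X ^ (i : ℕ))
  let M : Matrix (Fin f.natDegree) (Fin f.natDegree) ℂ[X] := Matrix.of c
  refine ⟨M.charpoly, M.charpoly_monic, by rw [Matrix.charpoly_natDegree_eq_dim, Fintype.card_fin], ?_⟩
  rw [← eval_map, ← Matrix.charpoly_map, Matrix.eval_charpoly, ← Matrix.exists_mulVec_eq_zero_iff]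
  refine ⟨fun i => X ^ (i : ℕ), ?_, ?_⟩
  · intro h
    have := congrFun h ⟨0, hf⟩
    simp at this
  · ext1 i
    rw [Matrix.sub_mulVec, Pi.sub_apply, Pi.zero_apply, sub_eq_zero]
    rw [show (Matrix.scalar (Fin f.natDegree) g).mulVec (fun i => X ^ (i : ℕ)) i = g * X ^ (i : ℕ) by
      simp [Matrix.scalar_apply, Matrix.mulVec_diagonal], hc i]
    rfl

theorem deg_dvd (f g : ℂ[X]) (hf : 0 < f.natDegree) (hg : 0 < g.natDegree)
    (hs : ∀ h : ℂ[X], ∃ H : ℂ[X][X], H.eval₂ (compRingHom f) g = h) :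
    f.natDegree ∣ g.natDegree ∨ g.natDegree ∣ f.natDegree := by
  have : NeZero f.natDegree := ⟨hf.ne'⟩
  obtain ⟨P, hP, hPn, hP0⟩ := exists_P hf g
  have hg0 : g ≠ 0 := by rintro rfl; simp at hg
  refine core (VV hf g) (algebraMap ℂ[X] (RatFunc ℂ)) ?_ P hP hPn ?_ ?_ g.natDegree hg ?_
  · intro k hk
    obtain ⟨H, hH⟩ := hs (X ^ k)
    refine ⟨H %ₘ P, ?_, ?_⟩
    · rw [← hPn, ← degree_eq_natDegree hP.ne_zero]; exact degree_modByMonic_lt _ hP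
    · have h1 := modByMonic_add_div H P
      rw [← h1, eval₂_add, eval₂_mul, hP0, zero_mul, add_zero] at hH
      rw [VV_map, hH, vE_poly (pow_ne_zero _ X_ne_zero), natDegree_X_pow]
  · rw [VV_map, hP0, map_zero, vE_zero]
  · intro a z hz
    have h1 : (VV hf g).v (C (algebraMap ℂ[X] (RatFunc ℂ) a)) = vE (algebraMap ℂ[X] (RatFunc ℂ) (a.comp f)) := by
      show vE _ = _
      rw [eval₂_C, phi_alg]
    rw [h1] at hz
    by_cases h0 : a.comp f = 0
    · rw [h0, map_zero, vE_zero] at hz; exact absurd hz WithBot.bot_ne_coe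
    · rw [vE_poly h0, WithBot.coe_inj] at hz
      rw [← hz]; exact Int.natCast_nonneg _
  · show vE _ = _
    rw [eval₂_X, vE_poly hg0]

end AMS

end

open MvPolynomial

namespace AMS

abbrev S2 := MvPolynomial (Fin 2) ℂ

noncomputable def ev (f g : Polynomial ℂ) : S2 →ₐ[ℂ] Polynomial ℂ := aeval ![f, g]

lemma ev_lift (f g : Polynomial ℂ) (W : S2) :
    (aeval ![Polynomial.C Polynomial.X, Polynomial.X] W : Polynomial (Polynomial ℂ)).eval₂
      (Polynomial.compRingHom f) g = ev f g W := by
  induction W using MvPolynomial.induction_on with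
  | C a =>
    simp only [MvPolynomial.algHom_C, ev]
    rw [IsScalarTower.algebraMap_apply ℂ (Polynomial ℂ) (Polynomial (Polynomial ℂ))]
    simp [Polynomial.algebraMap_eq]
  | add p q hp hq => simp only [map_add, Polynomial.eval₂_add, hp, hq]
  | mul_X p i hp =>
    simp only [map_mul, Polynomial.eval₂_mul, hp]
    fin_cases i <;> simp [ev]

/-- elementary automorphism `x ↦ x - q(y)` etc. via inverse pair -/
lemma mkEquiv (a b a' b' : S2)
    (h1 : aeval ![a, b] a' = (X 0 : S2)) (h2 : aeval ![a, b] b' = (X 1 : S2))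
    (h3 : aeval ![a', b'] a = (X 0 : S2)) (h4 : aeval ![a', b'] b = (X 1 : S2)) :
    ∃ φ : S2 ≃ₐ[ℂ] S2, φ (X 0) = a ∧ φ (X 1) = b := by
  refine ⟨AlgEquiv.ofAlgHom (aeval ![a, b]) (aeval ![a', b']) ?_ ?_, ?_, ?_⟩
  · apply MvPolynomial.algHom_ext; intro i; fin_cases i
    · simpa [aeval_eq_bind₁] using h1
    · simpa [aeval_eq_bind₁] using h2
  · apply MvPolynomial.algHom_ext; intro i; fin_cases i
    · simpa [aeval_eq_bind₁] using h3
    · simpa [aeval_eq_bind₁] using h4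
  · simp
  · simp

lemma ev_comp (f g : Polynomial ℂ) (φ : S2 ≃ₐ[ℂ] S2) (W : S2) :
    ev f g (φ W) = ev (ev f g (φ (X 0))) (ev f g (φ (X 1))) W := by
  have : (ev f g).comp (φ : S2 →ₐ[ℂ] S2) = ev (ev f g (φ (X 0))) (ev f g (φ (X 1))) := by
    apply MvPolynomial.algHom_ext; intro i; fin_cases i <;> simp [ev]
  exact DFunLike.congr_fun this W

lemma reduce (f g : Polynomial ℂ) (hf : 0 < f.natDegree) (hg : 0 < g.natDegree)
    (h : f.natDegree ∣ g.natDegree) : ∃ (c : ℂ) (k : ℕ),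
      (g - Polynomial.C c * f ^ k).natDegree < g.natDegree := by
  obtain ⟨k, hk⟩ := h
  have hf0 : f ≠ 0 := by rintro rfl; simp at hf
  have hg0 : g ≠ 0 := by rintro rfl; simp at hg
  have hl : f.leadingCoeff ^ k ≠ 0 := pow_ne_zero _ (Polynomial.leadingCoeff_ne_zero.2 hf0)
  have hl' := Polynomial.leadingCoeff_ne_zero.2 hg0
  refine ⟨g.leadingCoeff / f.leadingCoeff ^ k, k, ?_⟩
  have hlt : (g - Polynomial.C (g.leadingCoeff / f.leadingCoeff ^ k) * f ^ k).degree < g.degree := by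
    apply Polynomial.degree_sub_lt_left _ hg0
    · rw [Polynomial.leadingCoeff_mul, Polynomial.leadingCoeff_C, Polynomial.leadingCoeff_pow,
        div_mul_cancel₀ _ hl]
    · rw [Polynomial.degree_C_mul (div_ne_zero hl' hl), Polynomial.degree_eq_natDegree hg0,
        Polynomial.degree_eq_natDegree (pow_ne_zero _ hf0), Polynomial.natDegree_pow, hk, mul_comm]
  by_cases h0 : g - Polynomial.C (g.leadingCoeff / f.leadingCoeff ^ k) * f ^ k = 0
  · rw [h0, Polynomial.natDegree_zero]; exact hg
  · exact Polynomial.natDegree_lt_natDegree h0 hlt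

theorem straighten (N : ℕ) (f g : Polynomial ℂ) (hN : f.natDegree + g.natDegree = N)
    (hs : Function.Surjective (ev f g)) : ∃ φ : S2 ≃ₐ[ℂ] S2, ev f g (φ (X 0)) = 0 := by
  induction N using Nat.strong_induction_on generalizing f g with
  | _ N ih =>
  have step : ∀ φ : S2 ≃ₐ[ℂ] S2,
      (ev f g (φ (X 0))).natDegree + (ev f g (φ (X 1))).natDegree < N →
      ∃ φ : S2 ≃ₐ[ℂ] S2, ev f g (φ (X 0)) = 0 := by
    intro φ hlt
    obtain ⟨ψ, hψ⟩ := ih _ hlt _ _ rfl (by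
      intro h
      obtain ⟨W, hW⟩ := hs h
      refine ⟨φ.symm W, ?_⟩
      rw [← ev_comp, AlgEquiv.apply_symm_apply, hW])
    refine ⟨ψ.trans φ, ?_⟩
    rw [AlgEquiv.trans_apply, ev_comp, hψ]
  rcases Nat.eq_zero_or_pos f.natDegree with hf | hf
  · obtain ⟨φ, h0, -⟩ := mkEquiv (X 0 - C (f.coeff 0)) (X 1) (X 0 + C (f.coeff 0)) (X 1)
      (by simp) (by simp) (by simp) (by simp)
    refine ⟨φ, ?_⟩
    rw [h0, Polynomial.eq_C_of_natDegree_eq_zero hf]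
    simp [ev, Polynomial.algebraMap_eq]
  rcases Nat.eq_zero_or_pos g.natDegree with hg | hg
  · obtain ⟨φ, h0, -⟩ := mkEquiv (X 1 - C (g.coeff 0)) (X 0) (X 1) (X 0 + C (g.coeff 0))
      (by simp) (by simp) (by simp) (by simp)
    refine ⟨φ, ?_⟩
    rw [h0, Polynomial.eq_C_of_natDegree_eq_zero hg]
    simp [ev, Polynomial.algebraMap_eq]
  have hdv := deg_dvd f g hf hg (fun h => by
    obtain ⟨W, hW⟩ := hs h
    exact ⟨_, (ev_lift f g W).trans hW⟩)
  rcases hdv with hdv | hdv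
  · obtain ⟨c, k, hck⟩ := reduce f g hf hg hdv
    obtain ⟨φ, h0, h1⟩ := mkEquiv (X 0) (X 1 - C c * X 0 ^ k) (X 0) (X 1 + C c * X 0 ^ k)
      (by simp) (by simp) (by simp) (by simp)
    apply step φ
    rw [h0, h1]
    have e0 : ev f g (X 0) = f := by simp [ev]
    have e1 : ev f g (X 1 - C c * X 0 ^ k) = g - Polynomial.C c * f ^ k := by
      simp [ev, Polynomial.algebraMap_eq]
    rw [e0, e1]; omega
  · obtain ⟨c, k, hck⟩ := reduce g f hg hf hdv
    obtain ⟨φ, h0, h1⟩ := mkEquiv (X 0 - C c * X 1 ^ k) (X 1) (X 0 + C c * X 1 ^ k) (X 1)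
      (by simp) (by simp) (by simp) (by simp)
    apply step φ
    rw [h0, h1]
    have e0 : ev f g (X 1) = g := by simp [ev]
    have e1 : ev f g (X 0 - C c * X 1 ^ k) = f - Polynomial.C c * g ^ k := by
      simp [ev, Polynomial.algebraMap_eq]
    rw [e0, e1]; omega

end AMS

theorem abhyankar_moh_suzuki
    (p : MvPolynomial (Fin 2) ℂ)
    (h : Nonempty ((MvPolynomial (Fin 2) ℂ ⧸ Ideal.span {p}) ≃ₐ[ℂ] Polynomial ℂ)) :
    ∃ φ : MvPolynomial (Fin 2) ℂ ≃ₐ[ℂ] MvPolynomial (Fin 2) ℂ,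
      φ p = X 0 := by
  obtain ⟨e⟩ := h
  let Ψ : MvPolynomial (Fin 2) ℂ →ₐ[ℂ] Polynomial ℂ :=
    (e : _ →ₐ[ℂ] Polynomial ℂ).comp (Ideal.Quotient.mkₐ ℂ (Ideal.span {p}))
  have hΨ : Ψ = AMS.ev (Ψ (X 0)) (Ψ (X 1)) := by
    apply MvPolynomial.algHom_ext; intro i; fin_cases i <;> simp [AMS.ev]
  have hΨs : Function.Surjective Ψ := e.surjective.comp (Ideal.Quotient.mkₐ_surjective ℂ _)
  have hker : ∀ W, Ψ W = 0 → p ∣ W := by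
    intro W hW
    have h1 : e (Ideal.Quotient.mk (Ideal.span {p}) W) = 0 := hW
    rw [EmbeddingLike.map_eq_zero_iff, Ideal.Quotient.eq_zero_iff_mem, Ideal.mem_span_singleton] at h1
    exact h1
  have hp0 : Ψ p = 0 := by
    have : Ideal.Quotient.mk (Ideal.span {p}) p = 0 :=
      Ideal.Quotient.eq_zero_iff_mem.2 (Ideal.mem_span_singleton_self p)
    show e (Ideal.Quotient.mk (Ideal.span {p}) p) = 0
    rw [this, map_zero]
  obtain ⟨φ, hφ⟩ := AMS.straighten _ (Ψ (X 0)) (Ψ (X 1)) rfl (hΨ ▸ hΨs)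
  rw [← hΨ] at hφ
  have hdvd : φ.symm p ∣ X 0 := by
    have := map_dvd φ.symm (hker _ hφ)
    rwa [AlgEquiv.symm_apply_apply] at this
  have hnu : ¬ IsUnit (φ.symm p) := by
    intro hu
    have h1 := hu.map φ
    rw [AlgEquiv.apply_symm_apply] at h1
    have h2 := h1.map Ψ
    rw [hp0] at h2
    exact not_isUnit_zero h2
  have hirr : Irreducible (X 0 : MvPolynomial (Fin 2) ℂ) := (MvPolynomial.X_prime (i := (0 : Fin 2))).irreducible
  obtain ⟨q, hq⟩ := hdvd
  have hqu : IsUnit q := (hirr.isUnit_or_isUnit hq).resolve_left hnu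
  obtain ⟨c, hc, rfl⟩ := (MvPolynomial.isUnit_iff_eq_C_of_isReduced).1 hqu
  have hc0 : c ≠ 0 := hc.ne_zero
  obtain ⟨θ, hθ, -⟩ := AMS.mkEquiv (C c * X 0) (X 1) (C c⁻¹ * X 0) (X 1)
    (by simp [MvPolynomial.algebraMap_eq, ← mul_assoc, ← C_mul, hc0])
    (by simp)
    (by simp [MvPolynomial.algebraMap_eq, ← mul_assoc, ← C_mul, hc0]) (by simp)
  refine ⟨φ.symm.trans θ, ?_⟩
  rw [AlgEquiv.trans_apply]
  have h3 : φ.symm p = C c⁻¹ * X 0 := by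
    rw [hq, mul_comm (φ.symm p), ← mul_assoc, ← C_mul, inv_mul_cancel₀ hc0, C_1, one_mul]
  rw [h3, map_mul, hθ, ← MvPolynomial.algebraMap_eq, AlgEquiv.commutes, MvPolynomial.algebraMap_eq,
    ← mul_assoc, ← C_mul, inv_mul_cancel₀ hc0, C_1, one_mul]
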